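/- arXiv:2605.01707 — 4 statements merged into one kernel-verified Lean document; each statement's English description precedes it below -/
import Mathlib

section
/- Let n ≥ 1, let a < t_s < b be real numbers, let z : (a, b) → ℝⁿ be continuous, and let F⁻, F⁺ : ℝⁿ × ℝ → ℝⁿ be continuous. Suppose z is differentiable on (a, t_s) with z'(t) = F⁻(z(t), t) for all t ∈ (a, t_s), and differentiable on (t_s, b) with z'(t) = F⁺(z(t), t) for all t ∈ (t_s, b). Write z_s = z(t_s). Then the left one-sided derivative of z at t_s exists and equals F⁻(z_s, t_s), the right one-sided derivative exists and equals F⁺(z_s, t_s), and if F⁻(z_s, t_s) ≠ F⁺(z_s, t_s) then z is not differentiable at t_s. -/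
open Set

/-- Hard switching destroys differentiability.  If a continuous trajectory
`z` satisfies `z' = F⁻(z, t)` before the switching instant `t_s` and `z' = F⁺(z, t)` after,
then the one-sided derivatives of `z` at `t_s` exist and equal `F⁻(z(t_s), t_s)` and
`F⁺(z(t_s), t_s)` respectively; if these disagree, `z` is not differentiable at `t_s`. -/
theorem hard_switch_kills_differentiability
    (n : ℕ) (hn : 1 ≤ n) (a ts b : ℝ) (hats : a < ts) (htsb : ts < b)
    (z : ℝ → EuclideanSpace ℝ (Fin n))
    (hzc : ContinuousOn z (Ioo a b))
    (Fm Fp : EuclideanSpace ℝ (Fin n) × ℝ → EuclideanSpace ℝ (Fin n))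
    (hFm : Continuous Fm) (hFp : Continuous Fp)
    (hminus : ∀ t ∈ Ioo a ts, HasDerivAt z (Fm (z t, t)) t)
    (hplus : ∀ t ∈ Ioo ts b, HasDerivAt z (Fp (z t, t)) t) :
    HasDerivWithinAt z (Fm (z ts, ts)) (Iio ts) ts ∧
    HasDerivWithinAt z (Fp (z ts, ts)) (Ioi ts) ts ∧
    (Fm (z ts, ts) ≠ Fp (z ts, ts) → ¬ DifferentiableAt ℝ z ts) := by
  have hzt : ContinuousAt z ts := hzc.continuousAt (Ioo_mem_nhds hats htsb)
  have field_tendsto : ∀ F : EuclideanSpace ℝ (Fin n) × ℝ → EuclideanSpace ℝ (Fin n),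
      Continuous F → Filter.Tendsto (fun t => F (z t, t)) (nhds ts) (nhds (F (z ts, ts))) :=
    fun F hF => hF.continuousAt.comp (hzt.prodMk continuousAt_id)
  have hleft : HasDerivWithinAt z (Fm (z ts, ts)) (Iio ts) ts := by
    have hmem : Ioo a ts ∈ nhdsWithin ts (Iio ts) := Ioo_mem_nhdsLT hats
    refine (hasDerivWithinAt_Iic_of_tendsto_deriv
      (fun t ht => (hminus t ht).differentiableAt.differentiableWithinAt)
      hzt.continuousWithinAt hmem ?_).mono Iio_subset_Iic_self
    refine ((field_tendsto Fm hFm).mono_left nhdsWithin_le_nhds).congr' ?_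
    filter_upwards [hmem] with t ht using (hminus t ht).deriv.symm
  have hright : HasDerivWithinAt z (Fp (z ts, ts)) (Ioi ts) ts := by
    have hmem : Ioo ts b ∈ nhdsWithin ts (Ioi ts) := Ioo_mem_nhdsGT htsb
    refine (hasDerivWithinAt_Ici_of_tendsto_deriv
      (fun t ht => (hplus t ht).differentiableAt.differentiableWithinAt)
      hzt.continuousWithinAt hmem ?_).mono Ioi_subset_Ici_self
    refine ((field_tendsto Fp hFp).mono_left nhdsWithin_le_nhds).congr' ?_
    filter_upwards [hmem] with t ht using (hplus t ht).deriv.symm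
  refine ⟨hleft, hright, fun hne hd => hne ?_⟩
  have hderiv := hd.hasDerivAt
  exact ((uniqueDiffWithinAt_Iio ts).eq_deriv _ hleft hderiv.hasDerivWithinAt).trans
    ((uniqueDiffWithinAt_Ioi ts).eq_deriv _ hderiv.hasDerivWithinAt hright)
end

section
/- Let n, m ≥ 1, and let F : ℝⁿ × ℝ^m → ℝⁿ satisfy, for constants L, M > 0, the bounds ‖F(z₁, u) − F(z₂, u)‖ ≤ L‖z₁ − z₂‖ and ‖F(z, u₁) − F(z, u₂)‖ ≤ M‖u₁ − u₂‖ for all z, z₁, z₂ ∈ ℝⁿ and u, u₁, u₂ ∈ ℝ^m. Let t_k < b, let τ ∈ (0, b − t_k], let u, u_τ : [t_k, b] → ℝ^m be continuous with u_τ(t) = u(t) for all t ∈ [t_k + τ, b] and ‖u_τ(t) − u(t)‖ ≤ Δ for all t ∈ [t_k, t_k + τ], for some constant Δ ≥ 0. Let z, z_τ : [t_k, b] → ℝⁿ be differentiable with z(t_k) = z_τ(t_k), z'(t) = F(z(t), u(t)), and z_τ'(t) = F(z_τ(t), u_τ(t)) for all t ∈ [t_k, b]. Then sup over t ∈ [t_k,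 b] of ‖z_τ(t) − z(t)‖ is at most M · Δ · τ · e^{L(b − t_k)}. In particular, this supremum tends to 0 as τ tends to 0. -/
open Set

/-- The Grönwall bound with inhomogeneity `ε` is at most `(δ + ε x) e^{K x}`. -/
theorem gronwallBound_le_add_mul_mul_exp {δ K ε x : ℝ} (hK : 0 < K) (hε : 0 ≤ ε) :
    gronwallBound δ K ε x ≤ (δ + ε * x) * Real.exp (K * x) := by
  rw [gronwallBound_of_K_ne_0 hK.ne']
  have hexp : Real.exp (K * x) - 1 ≤ K * x * Real.exp (K * x) := by
    have h := mul_le_mul_of_nonneg_right (Real.one_sub_le_exp_neg (K * x))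
      (Real.exp_pos (K * x)).le
    rw [← Real.exp_add, neg_add_cancel, Real.exp_zero] at h
    linarith
  calc δ * Real.exp (K * x) + ε / K * (Real.exp (K * x) - 1)
      ≤ δ * Real.exp (K * x) + ε / K * (K * x * Real.exp (K * x)) := by gcongr
    _ = (δ + ε * x) * Real.exp (K * x) := by field_simp

/-- Gronwall-type bound comparing the trajectory driven by a scheduled
control `u` with the trajectory driven by a smoothed control `u_τ`, which differs from
`u` only on the window `[t_k, t_k + τ]` by at most `Δ`.  The state deviation over the
whole horizon `[t_k, b]` is bounded by `M·Δ·τ·e^{L(b − t_k)}`. -/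
theorem smoothed_trajectory_error_bound
    (n m : ℕ) (hn : 1 ≤ n) (hm : 1 ≤ m)
    (F : EuclideanSpace ℝ (Fin n) × EuclideanSpace ℝ (Fin m) → EuclideanSpace ℝ (Fin n))
    (L M : ℝ) (hL : 0 < L) (hM : 0 < M)
    (hFLip : ∀ (z₁ z₂ : EuclideanSpace ℝ (Fin n)) (u : EuclideanSpace ℝ (Fin m)),
      ‖F (z₁, u) - F (z₂, u)‖ ≤ L * ‖z₁ - z₂‖)
    (hFu : ∀ (z : EuclideanSpace ℝ (Fin n)) (u₁ u₂ : EuclideanSpace ℝ (Fin m)),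
      ‖F (z, u₁) - F (z, u₂)‖ ≤ M * ‖u₁ - u₂‖)
    (tk b : ℝ) (htkb : tk < b) (τ : ℝ) (hτ0 : 0 < τ) (hτb : τ ≤ b - tk)
    (Δ : ℝ) (hΔ : 0 ≤ Δ)
    (u uτ : ℝ → EuclideanSpace ℝ (Fin m))
    (hu : ContinuousOn u (Icc tk b)) (huτ : ContinuousOn uτ (Icc tk b))
    (hagree : ∀ t ∈ Icc (tk + τ) b, uτ t = u t)
    (hclose : ∀ t ∈ Icc tk (tk + τ), ‖uτ t - u t‖ ≤ Δ)
    (z zτ : ℝ → EuclideanSpace ℝ (Fin n))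
    (hinit : zτ tk = z tk)
    (hz : ∀ t ∈ Icc tk b, HasDerivWithinAt z (F (z t, u t)) (Icc tk b) t)
    (hzτ : ∀ t ∈ Icc tk b, HasDerivWithinAt zτ (F (zτ t, uτ t)) (Icc tk b) t) :
    ∀ t ∈ Icc tk b, ‖zτ t - z t‖ ≤ M * Δ * τ * Real.exp (L * (b - tk)) := by
  have hτb' : tk + τ ≤ b := by linarith
  have hcont : ContinuousOn (fun t => zτ t - z t) (Icc tk b) := fun t ht =>
    ((hzτ t ht).sub (hz t ht)).continuousWithinAt
  have hderiv : ∀ t ∈ Ico tk b,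
      HasDerivWithinAt (fun t => zτ t - z t) (F (zτ t, uτ t) - F (z t, u t)) (Ici t) t :=
    fun t ht => ((hzτ t (Ico_subset_Icc_self ht)).sub
      (hz t (Ico_subset_Icc_self ht))).mono_of_mem_nhdsWithin (Icc_mem_nhdsGE_of_mem ht)
  have hbound : ∀ t, ‖F (zτ t, uτ t) - F (z t, u t)‖
      ≤ L * ‖zτ t - z t‖ + M * ‖uτ t - u t‖ := fun t =>
    (norm_sub_le_norm_sub_add_norm_sub _ (F (z t, uτ t)) _).trans
      (add_le_add (hFLip _ _ _) (hFu _ _ _))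
  have hwindow : ∀ t ∈ Icc tk (tk + τ),
      ‖zτ t - z t‖ ≤ M * Δ * (t - tk) * Real.exp (L * (t - tk)) := by
    intro t ht
    have h := norm_le_gronwallBound_of_norm_deriv_right_le (δ := 0) (K := L) (ε := M * Δ)
      (hcont.mono (Icc_subset_Icc_right hτb'))
      (fun s hs => hderiv s (Ico_subset_Ico_right hτb' hs)) (by simp [hinit])
      (fun s hs => (hbound s).trans (by gcongr; exact hclose s (Ico_subset_Icc_self hs))) t ht
    simpa using h.trans (gronwallBound_le_add_mul_mul_exp hL (by positivity))
  intro t ht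
  rcases le_total t (tk + τ) with htτ | htτ
  · have : t - tk ≤ τ := by linarith
    have : t ≤ b := ht.2
    exact (hwindow t ⟨ht.1, htτ⟩).trans (by gcongr)
  · have hstart := hwindow (tk + τ) ⟨by linarith, le_rfl⟩
    rw [add_sub_cancel_left] at hstart
    have h := norm_le_gronwallBound_of_norm_deriv_right_le (K := L) (ε := 0)
      (hcont.mono (Icc_subset_Icc_left (by linarith)))
      (fun s hs => hderiv s ⟨by linarith [hs.1], hs.2⟩) hstart
      (fun s hs => by simpa [hagree s (Ico_subset_Icc_self hs)] using hbound s) t ⟨htτ, ht.2⟩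
    rw [gronwallBound_ε0, mul_assoc _ (Real.exp _), ← Real.exp_add, ← mul_add,
      show τ + (t - (tk + τ)) = t - tk by ring] at h
    have : t ≤ b := ht.2
    exact h.trans (by gcongr)
end

section
/- Consider matrices N_J ∈ ℝ^{n_J×n_E} and N_A ∈ ℝ^{n_A×n_E}, symmetric positive definite matrices Λ_q ∈ ℝ^{n_E×n_E} and A^A ∈ ℝ^{n_A×n_A}, and a diagonal matrix K ∈ ℝ^{n_E×n_E} with strictly positive diagonal entries. Let q : I → ℝ^{n_E}, p^J : I → ℝ^{n_J}, p^A : I → ℝ^{n_A} be a consistent unforced trajectory on an interval I, i.e., q and p^A are differentiable, p^J is continuous, and for all t ∈ I: Λ_q q'(t) = N_Jᵀ p^J(t) + N_Aᵀ p^A(t) − K q(t), N_J q(t) = 0, and A^A (p^A)'(t) = −N_A q(t). Then the incremental hydraulic energy V(t) = ½ q(t)ᵀ Λ_q q(t) + ½ p^A(t)ᵀ A^A p^A(t) is differentiable on I with V'(t) = −q(t)ᵀ K q(t) ≤ 0 for all t ∈ I. -/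
open Set Matrix

/-- Product rule for the dot product of two differentiable vector-valued functions. -/
theorem HasDerivWithinAt.dotProduct {ι : Type*} [Fintype ι] {x y : ℝ → ι → ℝ} {x' y' : ι → ℝ}
    {s : Set ℝ} {t : ℝ} (hx : HasDerivWithinAt x x' s t) (hy : HasDerivWithinAt y y' s t) :
    HasDerivWithinAt (fun u => x u ⬝ᵥ y u) (x' ⬝ᵥ y t + x t ⬝ᵥ y') s t := by
  rw [hasDerivWithinAt_pi] at hx hy
  simpa only [_root_.dotProduct, Finset.sum_add_distrib] using
    HasDerivWithinAt.fun_sum fun i (_ : i ∈ Finset.univ) => (hx i).fun_mul (hy i)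

/-- The derivative of half the quadratic form of a symmetric matrix along a curve. -/
theorem Matrix.IsSymm.hasDerivWithinAt_half_quadratic {ι : Type*} [Fintype ι]
    {M : Matrix ι ι ℝ} (hM : M.IsSymm) {x : ℝ → ι → ℝ} {x' : ι → ℝ} {s : Set ℝ} {t : ℝ}
    (hx : HasDerivWithinAt x x' s t) :
    HasDerivWithinAt (fun u => (1 / 2) * (x u ⬝ᵥ (M *ᵥ x u))) (x t ⬝ᵥ (M *ᵥ x')) s t := by
  have hMx : HasDerivWithinAt (fun u => M *ᵥ x u) (M *ᵥ x') s t :=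
    M.mulVecLin.toContinuousLinearMap.hasFDerivAt.comp_hasDerivWithinAt t hx
  have hsymm : x' ⬝ᵥ (M *ᵥ x t) = x t ⬝ᵥ (M *ᵥ x') := by
    rw [dotProduct_mulVec, ← mulVec_transpose, hM.eq, dotProduct_comm]
  refine ((hx.dotProduct hMx).const_mul (1 / 2)).congr_deriv ?_
  rw [hsymm]
  ring

/-- Energy dissipation identity for the linearized hydraulic DAE.
Along any consistent unforced trajectory, the incremental hydraulic energy
`V(t) = ½ q(t)ᵀ Λ_q q(t) + ½ p^A(t)ᵀ A^A p^A(t)` is differentiable with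
`V'(t) = −q(t)ᵀ K q(t) ≤ 0`. -/
theorem energy_dissipation_identity
    (nJ nA nE : ℕ)
    (NJ : Matrix (Fin nJ) (Fin nE) ℝ) (NA : Matrix (Fin nA) (Fin nE) ℝ)
    (Λq : Matrix (Fin nE) (Fin nE) ℝ) (AA : Matrix (Fin nA) (Fin nA) ℝ)
    (hΛq : Λq.PosDef) (hAA : AA.PosDef)
    (κ : Fin nE → ℝ) (hκ : ∀ e, 0 < κ e)
    (K : Matrix (Fin nE) (Fin nE) ℝ) (hK : K = Matrix.diagonal κ)
    (I : Set ℝ) (hI : I.OrdConnected)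
    (q q' : ℝ → Fin nE → ℝ) (pJ : ℝ → Fin nJ → ℝ) (pA pA' : ℝ → Fin nA → ℝ)
    (hq : ∀ t ∈ I, HasDerivWithinAt q (q' t) I t)
    (hpA : ∀ t ∈ I, HasDerivWithinAt pA (pA' t) I t)
    (hpJ : ContinuousOn pJ I)
    (hlink : ∀ t ∈ I, Λq *ᵥ q' t = NJᵀ *ᵥ pJ t + NAᵀ *ᵥ pA t - K *ᵥ q t)
    (hjunction : ∀ t ∈ I, NJ *ᵥ q t = 0)
    (htank : ∀ t ∈ I, AA *ᵥ pA' t = -(NA *ᵥ q t))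
    (V : ℝ → ℝ)
    (hV : ∀ t : ℝ, V t = (1 / 2) * (q t ⬝ᵥ (Λq *ᵥ q t)) + (1 / 2) * (pA t ⬝ᵥ (AA *ᵥ pA t))) :
    ∀ t ∈ I, HasDerivWithinAt V (-(q t ⬝ᵥ (K *ᵥ q t))) I t ∧ -(q t ⬝ᵥ (K *ᵥ q t)) ≤ 0 := by
  intro t ht
  constructor
  · have hJ : q t ⬝ᵥ (NJᵀ *ᵥ pJ t) = 0 := by
      rw [dotProduct_mulVec, vecMul_transpose, hjunction t ht, zero_dotProduct]
    have hA : q t ⬝ᵥ (NAᵀ *ᵥ pA t) = pA t ⬝ᵥ (NA *ᵥ q t) := by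
      rw [dotProduct_mulVec, vecMul_transpose, dotProduct_comm]
    have hΛsymm : Λq.IsSymm := by simpa using hΛq.isHermitian
    have hAsymm : AA.IsSymm := by simpa using hAA.isHermitian
    rw [funext hV]
    refine ((hΛsymm.hasDerivWithinAt_half_quadratic (hq t ht)).fun_add
      (hAsymm.hasDerivWithinAt_half_quadratic (hpA t ht))).congr_deriv ?_
    rw [hlink t ht, htank t ht, dotProduct_sub, dotProduct_add, dotProduct_neg, hJ, hA]
    ring
  · have hKpos : K.PosSemidef := hK ▸ PosSemidef.diagonal fun e => (hκ e).le
    simpa using hKpos.dotProduct_mulVec_nonneg (q t)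
end

section
/- Consider matrices N_J ∈ ℝ^{n_J×n_E} and N_A ∈ ℝ^{n_A×n_E}, symmetric positive definite matrices Λ_q ∈ ℝ^{n_E×n_E} and A^A ∈ ℝ^{n_A×n_A}, and a diagonal matrix K ∈ ℝ^{n_E×n_E} with strictly positive diagonal entries. Suppose the linear map (x, w) ↦ N_Jᵀ x + N_Aᵀ w from ℝ^{n_J} × ℝ^{n_A} to ℝ^{n_E} is injective. Let q : I → ℝ^{n_E}, p^J : I → ℝ^{n_J}, p^A : I → ℝ^{n_A} be a consistent unforced trajectory on an open interval I, i.e., q and p^A are differentiable, p^J is continuous, and for all t ∈ I: Λ_q q'(t) = N_Jᵀ p^J(t) + N_Aᵀ p^A(t) − K q(t), N_J q(t) = 0, and A^A (p^A)'(t) = −N_A q(t). If q(t) = 0 for all t ∈ I, then p^J(t) = 0 and p^A(t) = 0 for all t ∈ I. -/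
open Set Matrix

/-- Invariant-set characterization for the linearized hydraulic DAE.
If the non-reservoir incidence map `(x, w) ↦ N_Jᵀ x + N_Aᵀ w` is injective, then along a
consistent unforced trajectory on an open interval with `q ≡ 0`, all head deviations
vanish: `p^J ≡ 0` and `p^A ≡ 0`. -/
theorem invariant_set_zero_heads
    (nJ nA nE : ℕ)
    (NJ : Matrix (Fin nJ) (Fin nE) ℝ) (NA : Matrix (Fin nA) (Fin nE) ℝ)
    (Λq : Matrix (Fin nE) (Fin nE) ℝ) (AA : Matrix (Fin nA) (Fin nA) ℝ)
    (hΛq : Λq.PosDef) (hAA : AA.PosDef)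
    (κ : Fin nE → ℝ) (hκ : ∀ e, 0 < κ e)
    (K : Matrix (Fin nE) (Fin nE) ℝ) (hK : K = Matrix.diagonal κ)
    (hinj : Function.Injective
      (fun xw : (Fin nJ → ℝ) × (Fin nA → ℝ) => NJᵀ *ᵥ xw.1 + NAᵀ *ᵥ xw.2))
    (a b : ℝ) (hab : a < b)
    (q q' : ℝ → Fin nE → ℝ) (pJ : ℝ → Fin nJ → ℝ) (pA pA' : ℝ → Fin nA → ℝ)
    (hq : ∀ t ∈ Ioo a b, HasDerivWithinAt q (q' t) (Ioo a b) t)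
    (hpA : ∀ t ∈ Ioo a b, HasDerivWithinAt pA (pA' t) (Ioo a b) t)
    (hpJ : ContinuousOn pJ (Ioo a b))
    (hlink : ∀ t ∈ Ioo a b, Λq *ᵥ q' t = NJᵀ *ᵥ pJ t + NAᵀ *ᵥ pA t - K *ᵥ q t)
    (hjunction : ∀ t ∈ Ioo a b, NJ *ᵥ q t = 0)
    (htank : ∀ t ∈ Ioo a b, AA *ᵥ pA' t = -(NA *ᵥ q t))
    (hq0 : ∀ t ∈ Ioo a b, q t = 0) :
    ∀ t ∈ Ioo a b, pJ t = 0 ∧ pA t = 0 := by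
  intro t ht
  have hderiv : q' t = 0 :=
    (isOpen_Ioo.uniqueDiffWithinAt ht).eq_deriv _ (hq t ht)
      ((hasDerivWithinAt_const t (Ioo a b) 0).congr hq0 (hq0 t ht))
  have hheads : NJᵀ *ᵥ pJ t + NAᵀ *ᵥ pA t = 0 := by
    simpa [hderiv, hq0 t ht] using (hlink t ht).symm
  have hzero : (pJ t, pA t) = (0, 0) := hinj (by simpa using hheads)
  exact Prod.mk.inj hzero
end
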